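/- Let A be a semiprime ring and I a proper two-sided ideal of A. Then I is a weakly nilary ideal of A if and only if I = 0 or I is a nilary ideal of A. -/

import Mathlib

/-!
Common definitions.

All rings are associative but not necessarily commutative and not necessarily unital,
so we work with `NonUnitalRing` and `TwoSidedIdeal`.

Since a non-unital ring has no `a ^ 0`, positive powers/products are indexed with a shift:
the index `n : ℕ` always corresponds to the positive exponent/length `n + 1`.
-/

/-- `posPow a n` is the positive power `a ^ (n + 1)` of `a`. -/
def posPow {A : Type*} [NonUnitalRing A] (a : A) : ℕ → A
  | 0 => a
  | n + 1 => posPow a n * a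

/-- An element of a (possibly non-unital) ring is nilpotent if
some positive power of it is `0`. -/
def IsNilpotentElem {A : Type*} [NonUnitalRing A] (a : A) : Prop :=
  ∃ n : ℕ, posPow a n = 0

/-- `IsProdLen S n x` means that `x` is a product of `n + 1` elements of `S`
(multiplied in order, which suffices by associativity). -/
inductive IsProdLen {A : Type*} [NonUnitalRing A] (S : Set A) : ℕ → A → Prop
  | single {a : A} : a ∈ S → IsProdLen S 0 a
  | mul {a x : A} {n : ℕ} : a ∈ S → IsProdLen S n x → IsProdLen S (n + 1) (a * x)

/-- The containment `J * K ⊆ I` of two-sided ideals, expressed elementwise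
(this is equivalent, since `J * K` is the additive closure of the set of
products and `I` is closed under addition). -/
def ProdLE {A : Type*} [NonUnitalRing A] (J K I : TwoSidedIdeal A) : Prop :=
  ∀ x ∈ J, ∀ y ∈ K, x * y ∈ I

/-- `J * K = 0` for two-sided ideals `J`, `K`, expressed elementwise. -/
def ProdEqZero {A : Type*} [NonUnitalRing A] (J K : TwoSidedIdeal A) : Prop :=
  ∀ x ∈ J, ∀ y ∈ K, x * y = 0

/-- The containment `J ^ (m + 1) ⊆ I`, expressed elementwise. -/
def PowLE {A : Type*} [NonUnitalRing A] (J : TwoSidedIdeal A) (m : ℕ)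
    (I : TwoSidedIdeal A) : Prop :=
  ∀ x : A, IsProdLen (J : Set A) m x → x ∈ I

/-- `J ^ (m + 1) = 0`, expressed elementwise; so `∃ m, PowEqZero J m` says that
`J` is a nilpotent ideal. -/
def PowEqZero {A : Type*} [NonUnitalRing A] (J : TwoSidedIdeal A) (m : ℕ) : Prop :=
  ∀ x : A, IsProdLen (J : Set A) m x → x = 0

/-- `I` is a completely nilary ideal: whenever `a * b ∈ I`, some positive power of `a`
or some positive power of `b` lies in `I`. -/
def IsCompletelyNilaryIdeal {A : Type*} [NonUnitalRing A] (I : TwoSidedIdeal A) : Prop :=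
  ∀ a b : A, a * b ∈ I → (∃ n : ℕ, posPow a n ∈ I) ∨ (∃ m : ℕ, posPow b m ∈ I)

/-- `A` is a completely nilary ring: whenever `a * b = 0`, `a` is nilpotent or
`b` is nilpotent. -/
def IsCompletelyNilaryRing (A : Type*) [NonUnitalRing A] : Prop :=
  ∀ a b : A, a * b = 0 → IsNilpotentElem a ∨ IsNilpotentElem b

/-- `I` is a nilary ideal: whenever `J * K ⊆ I` for two-sided ideals `J`, `K`, some
positive power of `J` or of `K` is contained in `I`. -/
def IsNilaryIdeal {A : Type*} [NonUnitalRing A] (I : TwoSidedIdeal A) : Prop :=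
  ∀ J K : TwoSidedIdeal A, ProdLE J K I →
    (∃ m : ℕ, PowLE J m I) ∨ (∃ n : ℕ, PowLE K n I)

/-- `A` is a nilary ring: whenever `J * K = 0` for two-sided ideals `J`, `K`, then `J`
or `K` is nilpotent. -/
def IsNilaryRing (A : Type*) [NonUnitalRing A] : Prop :=
  ∀ J K : TwoSidedIdeal A, ProdEqZero J K →
    (∃ m : ℕ, PowEqZero J m) ∨ (∃ n : ℕ, PowEqZero K n)

/-- `I` is a p-nilary ideal: the nilary condition for principal two-sided ideals. -/
def IsPNilaryIdeal {A : Type*} [NonUnitalRing A] (I : TwoSidedIdeal A) : Prop :=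
  ∀ a b : A, ProdLE (TwoSidedIdeal.span {a}) (TwoSidedIdeal.span {b}) I →
    (∃ m : ℕ, PowLE (TwoSidedIdeal.span {a}) m I) ∨
    (∃ n : ℕ, PowLE (TwoSidedIdeal.span {b}) n I)

/-- `A` is a p-nilary ring: whenever `J * K = 0` for principal two-sided ideals `J`, `K`,
then `J` or `K` is nilpotent. -/
def IsPNilaryRing (A : Type*) [NonUnitalRing A] : Prop :=
  ∀ a b : A, ProdEqZero (TwoSidedIdeal.span {a}) (TwoSidedIdeal.span {b}) →
    (∃ m : ℕ, PowEqZero (TwoSidedIdeal.span {a}) m) ∨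
    (∃ n : ℕ, PowEqZero (TwoSidedIdeal.span {b}) n)

/-- `I` is a weakly nilary ideal: `I` is proper, and whenever `0 ≠ J * K ⊆ I` for two-sided
ideals `J`, `K`, some positive power of `J` or of `K` is contained in `I`. -/
def IsWeaklyNilaryIdeal {A : Type*} [NonUnitalRing A] (I : TwoSidedIdeal A) : Prop :=
  I ≠ ⊤ ∧ ∀ J K : TwoSidedIdeal A, ¬ ProdEqZero J K → ProdLE J K I →
    (∃ m : ℕ, PowLE J m I) ∨ (∃ n : ℕ, PowLE K n I)

theorem IsProdLen.mono {A : Type*} [NonUnitalRing A] {S T : Set A} (h : S ⊆ T) {n : ℕ} {x : A}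
    (hx : IsProdLen S n x) : IsProdLen T n x := by
  induction hx with
  | single ha => exact .single (h ha)
  | mul ha _ ih => exact .mul (h ha) ih

theorem PowLE.anti_left {A : Type*} [NonUnitalRing A] {J J' I : TwoSidedIdeal A} (h : J ≤ J')
    {m : ℕ} (hm : PowLE J' m I) : PowLE J m I :=
  fun x hx => hm x (hx.mono fun _ ha => h ha)

theorem ProdLE.sup_sup {A : Type*} [NonUnitalRing A] {J K I : TwoSidedIdeal A}
    (h : ProdLE J K I) : ProdLE (J ⊔ I) (K ⊔ I) I := by
  intro x hx y hy
  obtain ⟨j, hj, i, hi, rfl⟩ := TwoSidedIdeal.mem_sup.1 hx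
  obtain ⟨k, hk, i', hi', rfl⟩ := TwoSidedIdeal.mem_sup.1 hy
  rw [add_mul, mul_add]
  exact I.add_mem (I.add_mem (h j hj k hk) (I.mul_mem_left _ _ hi')) (I.mul_mem_right _ _ hi)

theorem ProdEqZero.powEqZero {A : Type*} [NonUnitalRing A] {I : TwoSidedIdeal A}
    (h : ProdEqZero I I) : PowEqZero I 1 := by
  intro x hx
  cases hx with
  | mul ha hy =>
    cases hy with
    | single hb => exact h _ ha _ hb

/-- Let `A` be a semiprime ring (no nonzero nilpotent two-sided ideal)
and `I` a proper two-sided ideal of `A`.  Then `I` is weakly nilary iff `I = 0` or `I` is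
a nilary ideal. -/
theorem weaklyNilary_iff_bot_or_nilary_of_semiprime
    {A : Type*} [NonUnitalRing A]
    (hA : ∀ J : TwoSidedIdeal A, (∃ m : ℕ, PowEqZero J m) → J = ⊥)
    (I : TwoSidedIdeal A) (hI : I ≠ ⊤) :
    IsWeaklyNilaryIdeal I ↔ (I = ⊥ ∨ IsNilaryIdeal I) := by
  constructor
  · rintro ⟨-, hw⟩
    refine or_iff_not_imp_left.2 fun hbot J K hJK => ?_
    have hne : ¬ ProdEqZero (J ⊔ I) (K ⊔ I) := fun h0 => hbot <| hA I
      ⟨1, ProdEqZero.powEqZero fun x hx y hy =>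
        h0 x ((le_sup_right : I ≤ J ⊔ I) hx) y ((le_sup_right : I ≤ K ⊔ I) hy)⟩
    exact (hw _ _ hne hJK.sup_sup).imp (fun ⟨m, hm⟩ => ⟨m, hm.anti_left le_sup_left⟩)
      fun ⟨n, hn⟩ => ⟨n, hn.anti_left le_sup_left⟩
  · rintro (rfl | hn)
    · exact ⟨hI, fun J K hne hle => absurd
        (fun x hx y hy => (TwoSidedIdeal.mem_bot A).1 (hle x hx y hy)) hne⟩
    · exact ⟨hI, fun J K _ hle => hn J K hle⟩
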